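/- Let f be a smooth function on an open neighborhood U of 0 in ℝⁿ, let N ∈ ℕ, let ‖·‖ be a pseudo-norm on ℝⁿ, and set 𝒰 = {(x,t) ∈ U × ℝ : t·x ∈ U}. The following are equivalent: (i) f has weight ≥ N; (ii) f(x) = O(‖x‖^N) as x → 0; (iii) for every x ∈ ℝⁿ, f(t·x) = O(t^N) as t → 0; (iv) f∘δ_t = O(t^N) in C^∞(U) as t → 0; (v) there is a smooth function Θ on 𝒰 such that f(t·x) = t^N Θ(x,t) for all (x,t) ∈ 𝒰. -/

import Mathlib

open scoped BigOperators
open Filter Topology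

namespace Carnot

/-- Anisotropic dilation `t · x = (t^{w_1} x_1, …, t^{w_n} x_n)`. -/
def dil {n : ℕ} (w : Fin n → ℕ) (t : ℝ) (x : Fin n → ℝ) : Fin n → ℝ :=
  fun i => t ^ (w i) * x i

/-- Weighted length `⟨α⟩` of a multi-index. -/
def wlen {n : ℕ} (w : Fin n → ℕ) (α : Fin n → ℕ) : ℕ := ∑ i, w i * α i

/-- Length `|α|` of a multi-index. -/
def mlen {n : ℕ} (α : Fin n → ℕ) : ℕ := ∑ i, α i

/-- A vector field acting on a function: `(Xf)(x) = Df(x)[X(x)]`. -/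
noncomputable def vf {n : ℕ} (X : (Fin n → ℝ) → (Fin n → ℝ)) (f : (Fin n → ℝ) → ℝ) :
    (Fin n → ℝ) → ℝ :=
  fun x => fderiv ℝ f x (X x)

/-- Iterated action `X_I f = X_{i_1}(X_{i_2}(⋯(X_{i_k} f)))`. -/
noncomputable def vfSeq {n : ℕ} (X : Fin n → (Fin n → ℝ) → (Fin n → ℝ)) :
    List (Fin n) → ((Fin n → ℝ) → ℝ) → ((Fin n → ℝ) → ℝ)
  | [], f => f
  | i :: I, f => vf (X i) (vfSeq X I f)

/-- Weight `⟨I⟩` of a finite sequence of indices. -/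
def seqW {n : ℕ} (w : Fin n → ℕ) (I : List (Fin n)) : ℕ := (I.map w).sum

/-- The list `(1,…,1,2,…,2,…,n,…,n)` with `i` repeated `α i` times. -/
def multiList {n : ℕ} (α : Fin n → ℕ) : List (Fin n) :=
  (List.finRange n).flatMap fun i => List.replicate (α i) i

/-- `X^α f = X_1^{α_1} ⋯ X_n^{α_n} f`. -/
noncomputable def vfPow {n : ℕ} (X : Fin n → (Fin n → ℝ) → (Fin n → ℝ)) (α : Fin n → ℕ)
    (f : (Fin n → ℝ) → ℝ) : (Fin n → ℝ) → ℝ :=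
  vfSeq X (multiList α) f

/-- Partial derivative `∂^α f`. -/
noncomputable def pdPow {n : ℕ} (α : Fin n → ℕ) (f : (Fin n → ℝ) → ℝ) : (Fin n → ℝ) → ℝ :=
  vfPow (fun i => fun _ => Pi.single i (1 : ℝ)) α f

/-- Lie bracket of two vector fields. -/
noncomputable def lieBk {n : ℕ} (X Y : (Fin n → ℝ) → (Fin n → ℝ)) : (Fin n → ℝ) → (Fin n → ℝ) :=
  fun x => fderiv ℝ Y x (X x) - fderiv ℝ X x (Y x)

/-- A weight sequence: non-decreasing, positive, starting at `1`. -/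
structure IsWeight {n : ℕ} (w : Fin n → ℕ) : Prop where
  mono : Monotone w
  pos : ∀ i, 0 < w i
  first : ∀ h : 0 < n, w ⟨0, h⟩ = 1

/-- An `H`-frame on `V`. -/
structure IsHFrame {n : ℕ} (w : Fin n → ℕ) (X : Fin n → (Fin n → ℝ) → (Fin n → ℝ))
    (V : Set (Fin n → ℝ)) : Prop where
  smooth : ∀ j, ContDiffOn ℝ (⊤ : ℕ∞) (X j) V
  basis : ∀ x ∈ V, LinearIndependent ℝ fun j => X j x
  bracket : ∃ L : Fin n → Fin n → Fin n → (Fin n → ℝ) → ℝ,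
    (∀ i j k, ContDiffOn ℝ (⊤ : ℕ∞) (L i j k) V) ∧
    (∀ i j k, ¬ w k ≤ w i + w j → ∀ x ∈ V, L i j k x = 0) ∧
    ∀ i j, ∀ x ∈ V, lieBk (X i) (X j) x = ∑ k, L i j k x • X k x

/-- `f` has order `≥ N` at `a` with respect to the frame `X`. -/
def OrderGe {n : ℕ} (w : Fin n → ℕ) (X : Fin n → (Fin n → ℝ) → (Fin n → ℝ))
    (f : (Fin n → ℝ) → ℝ) (a : Fin n → ℝ) (N : ℕ) : Prop :=
  ∀ I : List (Fin n), seqW w I < N → vfSeq X I f a = 0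

/-- `f` has order exactly `N` at `a` with respect to the frame `X`. -/
def OrderEq {n : ℕ} (w : Fin n → ℕ) (X : Fin n → (Fin n → ℝ) → (Fin n → ℝ))
    (f : (Fin n → ℝ) → ℝ) (a : Fin n → ℝ) (N : ℕ) : Prop :=
  OrderGe w X f a N ∧ ∃ I : List (Fin n), seqW w I = N ∧ vfSeq X I f a ≠ 0

/-- `f` has weight `≥ N`. -/
def WeightGe {n : ℕ} (w : Fin n → ℕ) (f : (Fin n → ℝ) → ℝ) (N : ℤ) : Prop :=
  ∀ α : Fin n → ℕ, (wlen w α : ℤ) < N → pdPow α f 0 = 0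

/-- `f` has weight exactly `N`. -/
def WeightEq {n : ℕ} (w : Fin n → ℕ) (f : (Fin n → ℝ) → ℝ) (N : ℤ) : Prop :=
  WeightGe w f N ∧ ∃ α : Fin n → ℕ, (wlen w α : ℤ) = N ∧ pdPow α f 0 ≠ 0

/-- A pseudo-norm for the anisotropic dilations. -/
structure IsPseudoNorm {n : ℕ} (w : Fin n → ℕ) (ρ : (Fin n → ℝ) → ℝ) : Prop where
  cont : Continuous ρ
  nonneg : ∀ x, 0 ≤ ρ x
  pos : ∀ x, x ≠ 0 → 0 < ρ x
  homog : ∀ t x, ρ (dil w t x) = |t| * ρ x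

/-- Multi-indices with all entries `< B`. -/
def mIdx (n B : ℕ) : Finset (Fin n → ℕ) := Fintype.piFinset fun _ => Finset.range B

/-- The monomial `x^α`. -/
def monom {n : ℕ} (α : Fin n → ℕ) (x : Fin n → ℝ) : ℝ := ∏ i, x i ^ α i

/-- Taylor coefficient `(1/α!) ∂^α f(0)`. -/
noncomputable def taylorCoeff {n : ℕ} (α : Fin n → ℕ) (f : (Fin n → ℝ) → ℝ) : ℝ :=
  ((∏ i, Nat.factorial (α i) : ℕ) : ℝ)⁻¹ * pdPow α f 0

/-- The homogeneous part `f^[ℓ]` of degree `ℓ` of the Taylor series of `f` at `0`. -/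
noncomputable def homPart {n : ℕ} (w : Fin n → ℕ) (f : (Fin n → ℝ) → ℝ) (ℓ : ℕ) :
    (Fin n → ℝ) → ℝ :=
  fun x => ∑ α ∈ (mIdx n (ℓ + 1)).filter (fun α => wlen w α = ℓ),
    taylorCoeff α f * monom α x

/-- `u_t = O(t^m)` in `C^∞(U)` as `t → 0`. -/
def BigOC {n : ℕ} (U : Set (Fin n → ℝ)) (u : ℝ → (Fin n → ℝ) → ℝ) (m : ℤ) : Prop :=
  ∀ K : Set (Fin n → ℝ), K ⊆ U → IsCompact K → ∀ β : Fin n → ℕ,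
    ∃ C : ℝ, ∀ᶠ t in 𝓝[≠] (0 : ℝ), ∀ x ∈ K, |pdPow β (u t) x| ≤ C * |t| ^ m

/-- Componentwise `O(t^m)` in `C^∞(U)` for families of vector fields. -/
def BigOCVF {n : ℕ} (U : Set (Fin n → ℝ)) (u : ℝ → (Fin n → ℝ) → Fin n → ℝ)
    (m : ℤ) : Prop :=
  ∀ K : Set (Fin n → ℝ), K ⊆ U → IsCompact K → ∀ β : Fin n → ℕ, ∀ k : Fin n,
    ∃ C : ℝ, ∀ᶠ t in 𝓝[≠] (0 : ℝ), ∀ x ∈ K,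
      |pdPow β (fun y => u t y k) x| ≤ C * |t| ^ m

/-- `Θ = O_w(‖x‖^{w+m})` near `x = 0`. -/
def IsOw {n : ℕ} (w : Fin n → ℕ) (ρ : (Fin n → ℝ) → ℝ)
    (Θ : (Fin n → ℝ) → (Fin n → ℝ)) (m : ℤ) : Prop :=
  ∀ k, ∃ C : ℝ, ∀ᶠ x in 𝓝 (0 : Fin n → ℝ), |Θ x k| ≤ C * ρ x ^ ((w k : ℤ) + m)

/-- A `w`-homogeneous map. -/
def WHomog {n : ℕ} (w : Fin n → ℕ) (φ : (Fin n → ℝ) → (Fin n → ℝ)) : Prop :=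
  ∀ t x, φ (dil w t x) = dil w t (φ x)

/-- A map whose components are polynomial functions. -/
def IsPolyMap {n : ℕ} (φ : (Fin n → ℝ) → (Fin n → ℝ)) : Prop :=
  ∀ k, ∃ p : MvPolynomial (Fin n) ℝ, ∀ x, φ x k = MvPolynomial.eval x p

/-- A vector field homogeneous of degree `m`: `δ_t^* Y = t^m Y` for `t ≠ 0`. -/
def VFHomog {n : ℕ} (w : Fin n → ℕ) (Y : (Fin n → ℝ) → (Fin n → ℝ)) (m : ℤ) : Prop :=
  ∀ t : ℝ, t ≠ 0 → ∀ x k, (t : ℝ) ^ (-(w k : ℤ)) * Y (dil w t x) k = t ^ m * Y x k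

/-- A vector field has weight `W`: each component `X_k` has weight `≥ W + w_k`,
with equality for some `k`. -/
def VFWeightEq {n : ℕ} (w : Fin n → ℕ) (X : (Fin n → ℝ) → (Fin n → ℝ)) (W : ℤ) :
    Prop :=
  (∀ k, ∀ α : Fin n → ℕ, (wlen w α : ℤ) < W + w k →
    pdPow α (fun y => X y k) 0 = 0) ∧
  ∃ k, ∃ α : Fin n → ℕ, (wlen w α : ℤ) = W + w k ∧ pdPow α (fun y => X y k) 0 ≠ 0

/-- The homogeneous part `X^[ℓ]` of degree `ℓ` of a vector field. -/
noncomputable def vfPart {n : ℕ} (w : Fin n → ℕ) (X : (Fin n → ℝ) → (Fin n → ℝ)) (ℓ : ℤ) :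
    (Fin n → ℝ) → Fin n → ℝ :=
  fun x k => ∑ α ∈ (mIdx n ((ℓ + w k).toNat + 1)).filter
      (fun α => (wlen w α : ℤ) = ℓ + w k),
    taylorCoeff α (fun y => X y k) * monom α x

/-- `φ` produces privileged coordinates at `a` adapted to the `H`-frame `X`:
it is linearly adapted at `a` and each component has order `w_k` at `a`. -/
def PrivilegedAt {n : ℕ} (w : Fin n → ℕ) (X : Fin n → (Fin n → ℝ) → (Fin n → ℝ))
    (a : Fin n → ℝ) (φ : (Fin n → ℝ) → (Fin n → ℝ)) : Prop :=
  (∀ j, fderiv ℝ φ a (X j a) = Pi.single j 1) ∧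
  ∀ k, OrderEq w X (fun x => φ x k) a (w k)

section WeightedTaylor

open scoped ContDiff

/-- A parametric integral of a smooth function over a compact interval is smooth. -/
theorem contDiff_intervalIntegral {E : Type} [NormedAddCommGroup E] [NormedSpace ℝ E]
    [ProperSpace E] {F : Type} [NormedAddCommGroup F] [NormedSpace ℝ F]
    {g : E × ℝ → F} (hg : ContDiff ℝ ∞ g) (a b : ℝ) :
    ContDiff ℝ ∞ fun x => ∫ s in a..b, g (x, s) := by
  rw [contDiff_infty]
  intro k
  induction k generalizing F with
  | zero =>
    rw [Nat.cast_zero, contDiff_zero]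
    exact intervalIntegral.continuous_parametric_intervalIntegral_of_continuous'
      (f := fun x s => g (x, s)) hg.continuous a b
  | succ k ih =>
    set g' : E × ℝ → E →L[ℝ] F := fun p => (fderiv ℝ g p).comp (ContinuousLinearMap.inl ℝ E ℝ)
    have hg' : ContDiff ℝ ∞ g' :=
      (hg.fderiv_right (m := ∞) le_rfl).clm_comp contDiff_const
    have hpartial : ∀ x s, HasFDerivAt (fun y => g (y, s)) (g' (x, s)) x := fun x s =>
      ((hg.differentiable (by simp)) (x, s)).hasFDerivAt.comp x (hasFDerivAt_prodMk_left x s)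
    have hderiv : ∀ x, HasFDerivAt (fun x => ∫ s in a..b, g (x, s))
        (∫ s in a..b, g' (x, s)) x := by
      intro x
      obtain ⟨C, hC⟩ := ((isCompact_closedBall x 1).prod
        (isCompact_uIcc (a := a) (b := b))).exists_bound_of_continuousOn hg'.continuous.continuousOn
      refine intervalIntegral.hasFDerivAt_integral_of_dominated_of_fderiv_le
        (F' := fun x s => g' (x, s)) (bound := fun _ => C)
        (Metric.closedBall_mem_nhds x one_pos) ?_ ?_ ?_ ?_ ?_ ?_
      · exact Eventually.of_forall fun y =>
          (hg.continuous.comp (by fun_prop : Continuous fun s : ℝ => (y, s))).aestronglyMeasurable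
      · exact (hg.continuous.comp
          (by fun_prop : Continuous fun s : ℝ => (x, s))).intervalIntegrable _ _
      · exact (hg'.continuous.comp
          (by fun_prop : Continuous fun s : ℝ => (x, s))).aestronglyMeasurable
      · exact Eventually.of_forall fun s hs y hy => hC (y, s) ⟨hy, Set.uIoc_subset_uIcc hs⟩
      · exact intervalIntegrable_const
      · exact Eventually.of_forall fun s _ y _ => hpartial y s
    rw [Nat.cast_succ, contDiff_succ_iff_fderiv]
    refine ⟨fun x => (hderiv x).differentiableAt, by simp, ?_⟩
    rw [show fderiv ℝ (fun x => ∫ s in a..b, g (x, s)) = fun x => ∫ s in a..b, g' (x, s) from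
      funext fun x => (hderiv x).fderiv]
    exact ih hg'

/-- Hadamard's lemma. -/
theorem exists_eq_add_sum_mul {n : ℕ} {g : (Fin n → ℝ) → ℝ} (hg : ContDiff ℝ ∞ g) :
    ∃ h : Fin n → (Fin n → ℝ) → ℝ, (∀ i, ContDiff ℝ ∞ (h i)) ∧
      ∀ x, g x = g 0 + ∑ i, x i * h i x := by
  have hd : ContDiff ℝ ∞ (fderiv ℝ g) := hg.fderiv_right (m := ∞) le_rfl
  have hpart : ∀ i : Fin n, ContDiff ℝ ∞
      fun p : (Fin n → ℝ) × ℝ => fderiv ℝ g (p.2 • p.1) (Pi.single i 1) := fun i =>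
    (hd.comp (contDiff_snd.smul contDiff_fst)).clm_apply contDiff_const
  refine ⟨fun i x => ∫ s in (0 : ℝ)..1, fderiv ℝ g (s • x) (Pi.single i 1),
    fun i => contDiff_intervalIntegral (hpart i) 0 1, fun x => ?_⟩
  have hcont : ∀ i : Fin n, Continuous fun s : ℝ => fderiv ℝ g (s • x) (Pi.single i 1) :=
    fun i => (hpart i).continuous.comp (by fun_prop : Continuous fun s : ℝ => (x, s))
  have hline : ∀ s : ℝ, HasDerivAt (fun s : ℝ => g (s • x))
      (∑ i, x i * fderiv ℝ g (s • x) (Pi.single i 1)) s := by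
    intro s
    have h := ((hg.differentiable (by simp)) (s • x)).hasFDerivAt.comp_hasDerivAt s
      ((hasDerivAt_id s).smul_const x)
    convert! h using 1
    rw [one_smul]
    conv_rhs => rw [← Finset.univ_sum_single x, map_sum]
    refine Finset.sum_congr rfl fun i _ => ?_
    rw [← smul_eq_mul, ← map_smul, ← Pi.single_smul, smul_eq_mul, mul_one,
      Finset.univ_sum_single]
  have hint := intervalIntegral.integral_eq_sub_of_hasDerivAt (fun s _ => hline s)
    ((continuous_finsetSum _ fun i _ => (hcont i).const_mul (x i)).intervalIntegrable 0 1)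
  rw [intervalIntegral.integral_finsetSum fun i _ =>
    ((hcont i).const_mul (x i)).intervalIntegrable 0 1] at hint
  simp only [intervalIntegral.integral_const_mul, one_smul, zero_smul] at hint
  rw [hint]
  ring

variable {n : ℕ} {w : Fin n → ℕ}

/-- The coordinate frame `∂_1, …, ∂_n`. -/
def coordFrame (n : ℕ) : Fin n → (Fin n → ℝ) → (Fin n → ℝ) := fun i _ => Pi.single i 1

theorem pdPow_eq_vfSeq (α : Fin n → ℕ) (f : (Fin n → ℝ) → ℝ) :
    pdPow α f = vfSeq (coordFrame n) (multiList α) f := rfl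

theorem vfSeq_cons_apply (i : Fin n) (I : List (Fin n)) (f : (Fin n → ℝ) → ℝ) (x : Fin n → ℝ) :
    vfSeq (coordFrame n) (i :: I) f x =
      fderiv ℝ (vfSeq (coordFrame n) I f) x (Pi.single i 1) := rfl

theorem contDiff_vfSeq {f : (Fin n → ℝ) → ℝ} (hf : ContDiff ℝ ∞ f) (I : List (Fin n)) :
    ContDiff ℝ ∞ (vfSeq (coordFrame n) I f) := by
  induction I with
  | nil => exact hf
  | cons i I ih => exact (ih.fderiv_right (m := ∞) le_rfl).clm_apply contDiff_const

theorem vfSeq_add {f g : (Fin n → ℝ) → ℝ} (hf : ContDiff ℝ ∞ f) (hg : ContDiff ℝ ∞ g)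
    (I : List (Fin n)) :
    vfSeq (coordFrame n) I (f + g) = vfSeq (coordFrame n) I f + vfSeq (coordFrame n) I g := by
  induction I with
  | nil => rfl
  | cons i I ih =>
    ext x
    rw [Pi.add_apply, vfSeq_cons_apply, ih,
      fderiv_add ((contDiff_vfSeq hf I).differentiable (by simp) x)
        ((contDiff_vfSeq hg I).differentiable (by simp) x)]
    rfl

theorem vfSeq_const_smul (c : ℝ) (f : (Fin n → ℝ) → ℝ) (I : List (Fin n)) :
    vfSeq (coordFrame n) I (c • f) = c • vfSeq (coordFrame n) I f := by
  induction I with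
  | nil => rfl
  | cons i I ih =>
    ext x
    rw [vfSeq_cons_apply, ih, fderiv_const_smul_field]
    rfl

theorem vfSeq_sum {ι : Type*} {f : ι → (Fin n → ℝ) → ℝ} (hf : ∀ j, ContDiff ℝ ∞ (f j))
    (T : Finset ι) (I : List (Fin n)) :
    vfSeq (coordFrame n) I (∑ j ∈ T, f j) = ∑ j ∈ T, vfSeq (coordFrame n) I (f j) := by
  induction I with
  | nil => rfl
  | cons i I ih =>
    ext x
    rw [vfSeq_cons_apply, ih, fderiv_sum fun j _ =>
      (contDiff_vfSeq (hf j) I).differentiable (by simp) x]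
    simp [vfSeq_cons_apply]

theorem vfSeq_congr {f g : (Fin n → ℝ) → ℝ} {x : Fin n → ℝ} (h : f =ᶠ[𝓝 x] g)
    (I : List (Fin n)) : vfSeq (coordFrame n) I f =ᶠ[𝓝 x] vfSeq (coordFrame n) I g := by
  induction I with
  | nil => exact h
  | cons i I ih =>
    filter_upwards [ih.fderiv (𝕜 := ℝ)] with y hy
    rw [vfSeq_cons_apply, vfSeq_cons_apply, hy]

theorem weightGe_congr {f g : (Fin n → ℝ) → ℝ} (h : f =ᶠ[𝓝 0] g) {N : ℤ} (hf : WeightGe w f N) :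
    WeightGe w g N := fun α hα =>
  (vfSeq_congr h (multiList α)).eq_of_nhds.symm.trans (hf α hα)

theorem seqW_multiList (α : Fin n → ℕ) : seqW w (multiList α) = wlen w α := by
  simp [seqW, multiList, wlen, List.flatMap_def, List.sum_flatten,
    List.sum_ofFn, mul_comm, ← List.ofFn_eq_map, Function.comp_def]

theorem count_multiList (α : Fin n → ℕ) (i : Fin n) : (multiList α).count i = α i := by
  simp [multiList, List.count_flatMap, List.count_replicate, List.sum_ofFn, ← List.ofFn_eq_map,
    Function.comp_def]

/-! ### Dilations -/

theorem contDiff_dil (w : Fin n → ℕ) :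
    ContDiff ℝ ∞ fun p : (Fin n → ℝ) × ℝ => dil w p.2 p.1 := by
  unfold dil
  fun_prop

theorem dil_zero_left (hw : ∀ i, 0 < w i) (x : Fin n → ℝ) : dil w 0 x = 0 := by
  ext i
  simp [dil, (hw i).ne']

theorem dil_one (x : Fin n → ℝ) : dil w 1 x = x := by
  ext i
  simp [dil]

theorem dil_zero_right (t : ℝ) : dil w t 0 = 0 := by
  ext i
  simp [dil]

theorem tendsto_dil (hw : ∀ i, 0 < w i) (x : Fin n → ℝ) :
    Tendsto (fun t => dil w t x) (𝓝[≠] 0) (𝓝 0) := by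
  have h : Continuous fun t => dil w t x :=
    (contDiff_dil w).continuous.comp (by fun_prop : Continuous fun t : ℝ => (x, t))
  have h0 := h.tendsto 0
  rw [dil_zero_left hw] at h0
  exact h0.mono_left nhdsWithin_le_nhds

theorem dil_single (t : ℝ) (i : Fin n) (c : ℝ) :
    dil w t (Pi.single i c) = t ^ w i • Pi.single i c := by
  ext j
  by_cases h : j = i
  · subst h; simp [dil]
  · simp [dil, h]

/-- The dilation by a nonzero scalar as a linear equivalence. -/
noncomputable def dilEquiv (w : Fin n → ℕ) {t : ℝ} (ht : t ≠ 0) :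
    (Fin n → ℝ) ≃L[ℝ] (Fin n → ℝ) :=
  ContinuousLinearEquiv.piCongrRight fun i =>
    ContinuousLinearEquiv.unitsEquivAut ℝ (Units.mk0 (t ^ w i) (pow_ne_zero _ ht))

theorem coe_dilEquiv {t : ℝ} (ht : t ≠ 0) : ⇑(dilEquiv w ht) = dil w t := by
  ext x i
  simp [dilEquiv, dil, mul_comm]

theorem vfSeq_comp_dil {t : ℝ} (ht : t ≠ 0) (f : (Fin n → ℝ) → ℝ) (I : List (Fin n)) :
    vfSeq (coordFrame n) I (fun x => f (dil w t x)) =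
      fun x => t ^ seqW w I * vfSeq (coordFrame n) I f (dil w t x) := by
  induction I with
  | nil => simp [vfSeq, seqW]
  | cons i I ih =>
    ext x
    have hcomp : (fun x => t ^ seqW w I * vfSeq (coordFrame n) I f (dil w t x)) =
        t ^ seqW w I • (vfSeq (coordFrame n) I f ∘ dilEquiv w ht) := by
      ext y
      simp [coe_dilEquiv]
    rw [vfSeq_cons_apply, ih, hcomp, fderiv_const_smul_field, Pi.smul_apply,
      ContinuousLinearEquiv.comp_right_fderiv, vfSeq_cons_apply]
    simp [coe_dilEquiv, dil_single, seqW, pow_add]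
    ring

/-! ### Monomials -/

theorem contDiff_monom (α : Fin n → ℕ) : ContDiff ℝ ∞ (monom α) := by
  unfold monom
  fun_prop

theorem monom_dil (α : Fin n → ℕ) (t : ℝ) (x : Fin n → ℝ) :
    monom α (dil w t x) = t ^ wlen w α * monom α x := by
  simp [monom, dil, wlen, mul_pow, Finset.prod_mul_distrib, ← pow_mul, Finset.prod_pow_eq_pow_sum]

theorem monom_add_single (α : Fin n → ℕ) (i : Fin n) (x : Fin n → ℝ) :
    monom (α + Pi.single i 1) x = monom α x * x i := by
  have h : ∏ j, x j ^ (Pi.single i 1 : Fin n → ℕ) j = x i := by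
    rw [Finset.prod_eq_single i (fun j _ hj => by rw [Pi.single_eq_of_ne hj, pow_zero])
      (fun h => absurd (Finset.mem_univ i) h), Pi.single_eq_same, pow_one]
  simp only [monom, Pi.add_apply, pow_add, Finset.prod_mul_distrib, h]

theorem wlen_add_single (α : Fin n → ℕ) (i : Fin n) :
    wlen w (α + Pi.single i 1) = wlen w α + w i := by
  simp [wlen, mul_add, Finset.sum_add_distrib, Pi.single_apply]

theorem monom_apply_zero (α : Fin n → ℕ) : monom α 0 = if α = 0 then 1 else 0 := by
  split_ifs with h
  · simp [monom, h]
  · obtain ⟨i, hi⟩ := Function.ne_iff.mp h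
    exact Finset.prod_eq_zero (Finset.mem_univ i) (by simpa using hi)

theorem fderiv_monom_single (α : Fin n → ℕ) (x : Fin n → ℝ) (i : Fin n) :
    fderiv ℝ (monom α) x (Pi.single i 1) = α i * monom (α - Pi.single i 1) x := by
  have h : HasFDerivAt (monom α) (∑ j, (∏ k ∈ Finset.univ.erase j, x k ^ α k) •
      ((α j * x j ^ (α j - 1)) • (ContinuousLinearMap.proj j : (Fin n → ℝ) →L[ℝ] ℝ))) x := by
    unfold monom
    refine HasFDerivAt.finsetProd fun j _ => ?_
    exact (hasDerivAt_pow (α j) (x j)).comp_hasFDerivAt x (hasFDerivAt_apply j x)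
  rw [h.fderiv, sum_apply, Finset.sum_eq_single i]
  · have hmonom : monom (α - Pi.single i 1) x =
        x i ^ (α i - 1) * ∏ k ∈ Finset.univ.erase i, x k ^ α k := by
      rw [monom, ← Finset.mul_prod_erase _ _ (Finset.mem_univ i)]
      congr 1
      · simp
      · refine Finset.prod_congr rfl fun k hk => ?_
        simp [Finset.ne_of_mem_erase hk]
    simp [hmonom]
    ring
  · intro j _ hj
    simp [hj]
  · simp

theorem exists_vfSeq_monom_eq (β : Fin n → ℕ) (I : List (Fin n)) :
    ∃ c : ℝ, (c ≠ 0 ↔ ∀ i, I.count i ≤ β i) ∧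
      vfSeq (coordFrame n) I (monom β) = c • monom (fun i => β i - I.count i) := by
  induction I with
  | nil => exact ⟨1, by simp, by simp [vfSeq]⟩
  | cons i I ih =>
    obtain ⟨c, hc, hI⟩ := ih
    refine ⟨c * (β i - I.count i : ℕ), ?_, ?_⟩
    · rw [mul_ne_zero_iff, hc, Nat.cast_ne_zero]
      constructor
      · rintro ⟨h1, h2⟩ j
        have := h1 j
        rw [List.count_cons]
        split_ifs with hij
        · obtain rfl : i = j := by simpa using hij
          omega
        · simpa
      · intro h
        refine ⟨fun j => (List.count_le_count_cons).trans (h j), ?_⟩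
        have := h i
        rw [List.count_cons_self] at this
        omega
    · ext x
      rw [vfSeq_cons_apply, hI, fderiv_const_smul_field]
      simp only [Pi.smul_apply, smul_apply, fderiv_monom_single, smul_eq_mul,
        mul_assoc]
      congr 3
      ext j
      by_cases hij : j = i
      · subst hij; simp; omega
      · simp [hij, Ne.symm hij]

theorem pdPow_monom_zero {α β : Fin n → ℕ} (h : α ≠ β) : pdPow α (monom β) 0 = 0 := by
  obtain ⟨c, hc, hI⟩ := exists_vfSeq_monom_eq β (multiList α)
  simp only [count_multiList] at hc hI
  rw [pdPow_eq_vfSeq, hI, Pi.smul_apply, monom_apply_zero]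
  split_ifs with h0
  · have : ¬ ∀ i, α i ≤ β i := fun hle => h (funext fun i => by
      have := congrFun h0 i
      have := hle i
      simp at *
      omega)
    rw [not_not.mp (mt hc.mp this), zero_smul]
  · simp

theorem pdPow_monom_self_ne_zero (α : Fin n → ℕ) : pdPow α (monom α) 0 ≠ 0 := by
  obtain ⟨c, hc, hI⟩ := exists_vfSeq_monom_eq α (multiList α)
  simp only [count_multiList, le_refl, implies_true, iff_true] at hc hI
  rw [pdPow_eq_vfSeq, hI, Pi.smul_apply, monom_apply_zero, if_pos (by ext i; simp)]
  simpa using hc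

/-! ### Weighted expansions -/

/-- The span of the functions `x ↦ x^α g(x)` with `⟨α⟩ ≥ N` and `g` smooth. -/
def weightedSpan (w : Fin n → ℕ) (N : ℕ) : Submodule ℝ ((Fin n → ℝ) → ℝ) :=
  Submodule.span ℝ {f | ∃ α : Fin n → ℕ, N ≤ wlen w α ∧
    ∃ g : (Fin n → ℝ) → ℝ, ContDiff ℝ ∞ g ∧ f = fun x => monom α x * g x}

theorem monom_mul_mem_weightedSpan {N : ℕ} {α : Fin n → ℕ} (hα : N ≤ wlen w α)
    {g : (Fin n → ℝ) → ℝ} (hg : ContDiff ℝ ∞ g) :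
    (fun x => monom α x * g x) ∈ weightedSpan w N :=
  Submodule.subset_span ⟨α, hα, g, hg, rfl⟩

theorem mem_weightedSpan_zero {f : (Fin n → ℝ) → ℝ} (hf : ContDiff ℝ ∞ f) :
    f ∈ weightedSpan w 0 := by
  simpa [monom] using monom_mul_mem_weightedSpan (w := w) (Nat.zero_le (wlen w 0)) hf

theorem contDiff_of_mem_weightedSpan {N : ℕ} {f : (Fin n → ℝ) → ℝ} (hf : f ∈ weightedSpan w N) :
    ContDiff ℝ ∞ f := by
  induction hf using Submodule.span_induction with
  | mem f hf =>
    obtain ⟨α, -, g, hg, rfl⟩ := hf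
    exact (contDiff_monom α).mul hg
  | zero => exact contDiff_const
  | add f g _ _ hf hg => exact hf.add hg
  | smul c f _ hf => exact contDiff_const.smul hf

/-- The multi-indices of weighted length `k`. -/
def wIdx (w : Fin n → ℕ) (k : ℕ) : Finset (Fin n → ℕ) :=
  (mIdx n (k + 1)).filter fun α => wlen w α = k

theorem mem_wIdx (hw : ∀ i, 0 < w i) {k : ℕ} {α : Fin n → ℕ} : α ∈ wIdx w k ↔ wlen w α = k := by
  simp only [wIdx, mIdx, Finset.mem_filter, Fintype.mem_piFinset, Finset.mem_range,
    and_iff_right_iff_imp]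
  rintro rfl i
  have h := Finset.single_le_sum (f := fun i => w i * α i) (fun _ _ => Nat.zero_le _)
    (Finset.mem_univ i)
  exact Nat.lt_succ_of_le ((Nat.le_mul_of_pos_left _ (hw i)).trans h)

theorem exists_homogeneous_add_of_mem_weightedSpan (hw : ∀ i, 0 < w i) {k : ℕ}
    {f : (Fin n → ℝ) → ℝ} (hf : f ∈ weightedSpan w k) :
    ∃ c : (Fin n → ℕ) → ℝ, ∃ R ∈ weightedSpan w (k + 1),
      f = (∑ α ∈ wIdx w k, c α • monom α) + R := by
  induction hf using Submodule.span_induction with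
  | mem f hf =>
    obtain ⟨α, hα, g, hg, rfl⟩ := hf
    obtain hlt | heq := hα.lt_or_eq
    · exact ⟨0, _, monom_mul_mem_weightedSpan hlt hg, by simp⟩
    · obtain ⟨h, hh, hgh⟩ := exists_eq_add_sum_mul hg
      refine ⟨Pi.single α (g 0), ∑ i, fun x => monom (α + Pi.single i 1) x * h i x,
        Submodule.sum_mem _ fun i _ => monom_mul_mem_weightedSpan ?_ (hh i), ?_⟩
      · rw [wlen_add_single]
        have := hw i
        omega
      · ext x
        rw [Finset.sum_eq_single α (fun β _ hβ => by simp [hβ])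
          (fun h => absurd ((mem_wIdx hw).mpr heq.symm) h)]
        simp only [Pi.single_eq_same, Pi.add_apply, Pi.smul_apply, smul_eq_mul, Finset.sum_apply,
          monom_add_single]
        rw [hgh x, mul_add, Finset.mul_sum, mul_comm]
        simp only [mul_assoc]
  | zero => exact ⟨0, 0, Submodule.zero_mem _, by simp⟩
  | add f g _ _ hf hg =>
    obtain ⟨c, R, hR, rfl⟩ := hf
    obtain ⟨d, S, hS, rfl⟩ := hg
    refine ⟨c + d, R + S, Submodule.add_mem _ hR hS, ?_⟩
    simp only [Pi.add_apply, add_smul, Finset.sum_add_distrib]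
    abel
  | smul a f _ hf =>
    obtain ⟨c, R, hR, rfl⟩ := hf
    refine ⟨a • c, a • R, Submodule.smul_mem _ _ hR, ?_⟩
    simp only [Pi.smul_apply, smul_add, Finset.smul_sum, smul_smul, smul_eq_mul]

theorem exists_smooth_quotient_of_mem_weightedSpan {N : ℕ} {f : (Fin n → ℝ) → ℝ}
    (hf : f ∈ weightedSpan w N) :
    ∃ Θ : (Fin n → ℝ) × ℝ → ℝ, ContDiff ℝ ∞ Θ ∧
      ∀ p : (Fin n → ℝ) × ℝ, f (dil w p.2 p.1) = p.2 ^ N * Θ p := by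
  induction hf using Submodule.span_induction with
  | mem f hf =>
    obtain ⟨α, hα, g, hg, rfl⟩ := hf
    refine ⟨fun p => p.2 ^ (wlen w α - N) * monom α p.1 * g (dil w p.2 p.1), ?_, fun p => ?_⟩
    · exact ((contDiff_snd.pow _).mul ((contDiff_monom α).comp contDiff_fst)).mul
        (hg.comp (contDiff_dil w))
    · simp only [monom_dil]
      rw [← Nat.add_sub_of_le hα, pow_add]
      simp only [Nat.add_sub_cancel_left]
      ring
  | zero => exact ⟨0, contDiff_const, by simp⟩
  | add f g _ _ hf hg =>
    obtain ⟨Θ, hΘ, h⟩ := hf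
    obtain ⟨Ξ, hΞ, h'⟩ := hg
    exact ⟨Θ + Ξ, hΘ.add hΞ, fun p => by simp [h, h', mul_add]⟩
  | smul c f _ hf =>
    obtain ⟨Θ, hΘ, h⟩ := hf
    exact ⟨c • Θ, contDiff_const.smul hΘ, fun p => by simp [h]; ring⟩

/-! ### Smooth quotients, estimates in `C^∞`, and the weight -/

theorem eq_zero_of_eventually_pow_mul_le {k N : ℕ} (hkN : k < N) {a C : ℝ}
    (h : ∀ᶠ t in 𝓝[≠] (0 : ℝ), |t| ^ k * |a| ≤ C * |t| ^ N) : a = 0 := by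
  have hlim : Tendsto (fun t : ℝ => C * |t| ^ (N - k)) (𝓝[≠] 0) (𝓝 0) := by
    have hc : Continuous fun t : ℝ => C * |t| ^ (N - k) := by fun_prop
    simpa [(Nat.sub_pos_of_lt hkN).ne'] using (hc.tendsto 0).mono_left nhdsWithin_le_nhds
  have hle : ∀ᶠ t in 𝓝[≠] (0 : ℝ), |a| ≤ C * |t| ^ (N - k) := by
    filter_upwards [h, self_mem_nhdsWithin] with t ht ht0
    have hpos : 0 < |t| ^ k := pow_pos (abs_pos.mpr ht0) k
    rw [← Nat.add_sub_of_le hkN.le, pow_add] at ht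
    refine le_of_mul_le_mul_left (ht.trans_eq ?_) hpos
    ring
  exact abs_nonpos_iff.mp (ge_of_tendsto hlim hle)

theorem isOpen_dil_domain {U : Set (Fin n → ℝ)} (hU : IsOpen U) (w : Fin n → ℕ) :
    IsOpen {p : (Fin n → ℝ) × ℝ | p.1 ∈ U ∧ dil w p.2 p.1 ∈ U} :=
  (hU.preimage continuous_fst).inter (hU.preimage (contDiff_dil w).continuous)

theorem contDiffOn_vfSeq_slice {D : Set ((Fin n → ℝ) × ℝ)} (hD : IsOpen D)
    {Θ : (Fin n → ℝ) × ℝ → ℝ} (hΘ : ContDiffOn ℝ ∞ Θ D) (I : List (Fin n)) :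
    ContDiffOn ℝ ∞ (fun p => vfSeq (coordFrame n) I (fun x => Θ (x, p.2)) p.1) D := by
  induction I with
  | nil => exact hΘ
  | cons i I ih =>
    set Ψ : (Fin n → ℝ) × ℝ → ℝ := fun p => vfSeq (coordFrame n) I (fun x => Θ (x, p.2)) p.1
    have hsmooth : ContDiffOn ℝ ∞ (fun p => fderiv ℝ Ψ p (Pi.single i 1, 0)) D :=
      (ih.fderiv_of_isOpen hD (m := ∞) le_rfl).clm_apply contDiffOn_const
    refine hsmooth.congr fun ⟨x, t⟩ hp => ?_
    have hΨ : HasFDerivAt Ψ (fderiv ℝ Ψ (x, t)) (x, t) :=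
      ((ih.contDiffAt (hD.mem_nhds hp)).differentiableAt (by simp)).hasFDerivAt
    have hslice : HasFDerivAt (fun y => Ψ (y, t))
        ((fderiv ℝ Ψ (x, t)).comp (ContinuousLinearMap.inl ℝ (Fin n → ℝ) ℝ)) x :=
      HasFDerivAt.comp (f := fun y => (y, t)) x hΨ (hasFDerivAt_prodMk_left (𝕜 := ℝ) x t)
    exact DFunLike.congr_fun hslice.fderiv (Pi.single i 1)

theorem bigOC_of_smooth_quotient {U : Set (Fin n → ℝ)} (hU : IsOpen U) (h0 : (0 : Fin n → ℝ) ∈ U)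
    (hw : ∀ i, 0 < w i) {f : (Fin n → ℝ) → ℝ} {N : ℕ} {Θ : (Fin n → ℝ) × ℝ → ℝ}
    (hΘ : ContDiffOn ℝ ∞ Θ {p : (Fin n → ℝ) × ℝ | p.1 ∈ U ∧ dil w p.2 p.1 ∈ U})
    (hfΘ : ∀ p : (Fin n → ℝ) × ℝ, p.1 ∈ U → dil w p.2 p.1 ∈ U →
      f (dil w p.2 p.1) = p.2 ^ N * Θ p) :
    BigOC U (fun t x => f (dil w t x)) N := by
  intro K hKU hK β
  have hD := isOpen_dil_domain hU w
  set D := {p : (Fin n → ℝ) × ℝ | p.1 ∈ U ∧ dil w p.2 p.1 ∈ U}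
  set Ψ : (Fin n → ℝ) × ℝ → ℝ := fun p =>
    vfSeq (coordFrame n) (multiList β) (fun x => Θ (x, p.2)) p.1
  have hΨD : ContinuousOn Ψ D := (contDiffOn_vfSeq_slice hD hΘ _).continuousOn
  have hKD : ∀ x ∈ K, (x, (0 : ℝ)) ∈ D := fun x hx =>
    ⟨hKU hx, by simpa only [dil_zero_left hw] using h0⟩
  obtain ⟨C, hC⟩ := hK.exists_bound_of_continuousOn (f := fun x => Ψ (x, 0))
    (hΨD.comp (by fun_prop) hKD)
  refine ⟨C + 1, nhdsWithin_le_nhds (hK.eventually_forall_of_forall_eventually fun x hx => ?_)⟩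
  have hswap : Tendsto (fun z : ℝ × (Fin n → ℝ) => (z.2, z.1)) (𝓝 (0, x)) (𝓝 (x, 0)) :=
    continuous_swap.tendsto (0, x)
  have hmem : ∀ᶠ p in 𝓝 (x, (0 : ℝ)), p ∈ D ∧ |Ψ p| < C + 1 :=
    Eventually.and (hD.mem_nhds (hKD x hx)) <|
      (hΨD.continuousAt (hD.mem_nhds (hKD x hx))).abs.eventually_lt continuousAt_const
        ((hC x hx).trans_lt (lt_add_one C))
  filter_upwards [hswap.eventually hmem] with z hz
  have hgerm : (fun y => f (dil w z.1 y)) =ᶠ[𝓝 z.2] z.1 ^ N • fun y => Θ (y, z.1) := by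
    have hnear : ∀ᶠ y in 𝓝 z.2, (y, z.1) ∈ D :=
      (by fun_prop : Continuous fun y : Fin n → ℝ => (y, z.1)).continuousAt.eventually
        (hD.mem_nhds hz.1)
    filter_upwards [hnear] with y hy
    exact hfΘ (y, z.1) hy.1 hy.2
  rw [pdPow_eq_vfSeq, (vfSeq_congr hgerm _).eq_of_nhds, vfSeq_const_smul, Pi.smul_apply,
    smul_eq_mul, abs_mul, abs_pow, zpow_natCast, mul_comm]
  exact mul_le_mul_of_nonneg_right hz.2.le (by positivity)

theorem weightGe_of_bigOC {U : Set (Fin n → ℝ)} (h0 : (0 : Fin n → ℝ) ∈ U)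
    {f : (Fin n → ℝ) → ℝ} {N : ℕ} (h : BigOC U (fun t x => f (dil w t x)) N) :
    WeightGe w f N := by
  intro α hα
  obtain ⟨C, hC⟩ := h {0} (Set.singleton_subset_iff.mpr h0) isCompact_singleton α
  refine eq_zero_of_eventually_pow_mul_le (C := C) (Nat.cast_lt.mp hα) ?_
  filter_upwards [hC, self_mem_nhdsWithin] with t ht ht0
  have h_le := ht 0 rfl
  rw [pdPow_eq_vfSeq, vfSeq_comp_dil ht0, seqW_multiList, zpow_natCast] at h_le
  simpa only [dil_zero_right, abs_mul, abs_pow, ← pdPow_eq_vfSeq] using h_le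

theorem weightGe_of_mem_weightedSpan (hw : ∀ i, 0 < w i) {N : ℕ} {f : (Fin n → ℝ) → ℝ}
    (hf : f ∈ weightedSpan w N) : WeightGe w f N := by
  obtain ⟨Θ, hΘ, h⟩ := exists_smooth_quotient_of_mem_weightedSpan hf
  exact weightGe_of_bigOC (Set.mem_univ 0)
    (bigOC_of_smooth_quotient isOpen_univ (Set.mem_univ 0) hw hΘ.contDiffOn fun p _ _ => h p)

theorem mem_weightedSpan_of_weightGe (hw : ∀ i, 0 < w i) {N : ℕ} {f : (Fin n → ℝ) → ℝ}
    (hf : ContDiff ℝ ∞ f) (h : WeightGe w f N) : f ∈ weightedSpan w N := by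
  suffices ∀ k ≤ N, f ∈ weightedSpan w k from this N le_rfl
  intro k hk
  induction k with
  | zero => exact mem_weightedSpan_zero hf
  | succ k ih =>
    obtain ⟨c, R, hR, rfl⟩ := exists_homogeneous_add_of_mem_weightedSpan hw (ih (by omega))
    have hsmooth : ∀ α, ContDiff ℝ ∞ (c α • monom α) := fun α =>
      contDiff_const.smul (contDiff_monom α)
    have hP : ContDiff ℝ ∞ (∑ α ∈ wIdx w k, c α • monom α) := by
      simpa only [Finset.sum_fn] using ContDiff.sum (s := wIdx w k) fun α _ => hsmooth α
    have hc : ∀ α ∈ wIdx w k, c α = 0 := by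
      intro α hα
      have hαk := (mem_wIdx hw).mp hα
      have hRα : pdPow α R 0 = 0 := weightGe_of_mem_weightedSpan hw hR α (by omega)
      have hfα := h α (by omega)
      rw [pdPow_eq_vfSeq, vfSeq_add hP
        (contDiff_of_mem_weightedSpan hR), vfSeq_sum hsmooth, Pi.add_apply,
        ← pdPow_eq_vfSeq, hRα, add_zero, Finset.sum_apply, Finset.sum_eq_single α
          (fun β _ hβ => by
            rw [vfSeq_const_smul, ← pdPow_eq_vfSeq, Pi.smul_apply, pdPow_monom_zero hβ.symm,
              smul_zero])
          (fun h => absurd hα h), vfSeq_const_smul] at hfα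
      exact (mul_eq_zero.mp hfα).resolve_right (pdPow_monom_self_ne_zero α)
    rw [Finset.sum_eq_zero fun α hα => by rw [hc α hα, zero_smul], zero_add]
    exact hR

theorem mem_weightedSpan_of_isBigO (hw : ∀ i, 0 < w i) {N : ℕ} {f : (Fin n → ℝ) → ℝ}
    (hf : ContDiff ℝ ∞ f)
    (h : ∀ x, ∃ C : ℝ, ∀ᶠ t in 𝓝[≠] (0 : ℝ), |f (dil w t x)| ≤ C * |t| ^ N) :
    f ∈ weightedSpan w N := by
  suffices ∀ k ≤ N, f ∈ weightedSpan w k from this N le_rfl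
  intro k hk
  induction k with
  | zero => exact mem_weightedSpan_zero hf
  | succ k ih =>
    obtain ⟨c, R, hR, rfl⟩ := exists_homogeneous_add_of_mem_weightedSpan hw (ih (by omega))
    obtain ⟨Θ, hΘ, hRΘ⟩ := exists_smooth_quotient_of_mem_weightedSpan hR
    have hP : (∑ α ∈ wIdx w k, c α • monom α) = 0 := by
      ext x
      obtain ⟨C, hC⟩ := h x
      have hΘx : Continuous fun t : ℝ => |Θ (x, t)| :=
        (hΘ.continuous.comp (by fun_prop : Continuous fun t : ℝ => (x, t))).abs
      have hbound : ∀ᶠ t in 𝓝[≠] (0 : ℝ), |Θ (x, t)| < |Θ (x, 0)| + 1 :=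
        nhdsWithin_le_nhds (hΘx.continuousAt.eventually_lt continuousAt_const (lt_add_one _))
      have hsmall : ∀ᶠ t in 𝓝[≠] (0 : ℝ), |t| < 1 :=
        nhdsWithin_le_nhds (continuous_abs.continuousAt.eventually_lt continuousAt_const (by simp))
      refine eq_zero_of_eventually_pow_mul_le (C := |C| + (|Θ (x, 0)| + 1)) k.lt_succ_self ?_
      filter_upwards [hC, hbound, hsmall] with t ht htΘ ht1
      have hhom : (∑ α ∈ wIdx w k, c α • monom α) (dil w t x) =
          t ^ k * (∑ α ∈ wIdx w k, c α • monom α) x := by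
        simp only [Finset.sum_apply, Pi.smul_apply, smul_eq_mul, Finset.mul_sum, monom_dil]
        refine Finset.sum_congr rfl fun α hα => ?_
        rw [(mem_wIdx hw).mp hα]
        ring
      rw [Pi.add_apply, hhom, hRΘ (x, t)] at ht
      have hCt : C * |t| ^ N ≤ |C| * |t| ^ (k + 1) :=
        mul_le_mul (le_abs_self C) (pow_le_pow_of_le_one (abs_nonneg t) ht1.le hk)
          (by positivity) (abs_nonneg C)
      have hRt : |t ^ (k + 1) * Θ (x, t)| ≤ (|Θ (x, 0)| + 1) * |t| ^ (k + 1) := by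
        rw [abs_mul, abs_pow, mul_comm]
        exact mul_le_mul_of_nonneg_right htΘ.le (by positivity)
      have habs := abs_sub (t ^ k * (∑ α ∈ wIdx w k, c α • monom α) x + t ^ (k + 1) * Θ (x, t))
        (t ^ (k + 1) * Θ (x, t))
      rw [add_sub_cancel_right, abs_mul, abs_pow] at habs
      calc |t| ^ k * |(∑ α ∈ wIdx w k, c α • monom α) x|
          ≤ |C| * |t| ^ (k + 1) + (|Θ (x, 0)| + 1) * |t| ^ (k + 1) :=
            habs.trans (add_le_add (ht.trans hCt) hRt)
        _ = _ := (add_mul _ _ _).symm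
    rw [hP, zero_add]
    exact hR

/-! ### Pseudo-norms -/

namespace IsPseudoNorm

variable {ρ : (Fin n → ℝ) → ℝ}

theorem apply_zero (hρ : IsPseudoNorm w ρ) : ρ 0 = 0 := by
  simpa [dil_zero_right] using hρ.homog 0 0

theorem exists_norm_lt_one_of_lt (hρ : IsPseudoNorm w ρ) (hw : ∀ i, 0 < w i) :
    ∃ c > 0, ∀ x, ρ x < c → ‖x‖ < 1 := by
  obtain h | h := (Metric.sphere (0 : Fin n → ℝ) 1).eq_empty_or_nonempty
  · refine ⟨1, one_pos, fun x _ => ?_⟩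
    obtain rfl | hx := eq_or_ne x 0
    · simp
    · have hmem : ‖x‖⁻¹ • x ∈ Metric.sphere (0 : Fin n → ℝ) 1 := by
        simp [norm_smul, hx]
      exact absurd hmem (by simp [h])
  · obtain ⟨z, hz, hmin⟩ := (isCompact_sphere (0 : Fin n → ℝ) 1).exists_isMinOn h
      hρ.cont.continuousOn
    have hz0 : z ≠ 0 := ne_zero_of_mem_unit_sphere ⟨z, hz⟩
    refine ⟨ρ z, hρ.pos z hz0, fun x hx => ?_⟩
    by_contra! hx1
    have hcont : ContinuousOn (fun s => ‖dil w s x‖) (Set.Icc 0 1) :=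
      ((contDiff_dil w).continuous.comp
        (by fun_prop : Continuous fun s : ℝ => (x, s))).norm.continuousOn
    obtain ⟨s, hs, hs1⟩ := intermediate_value_Icc zero_le_one hcont
      (show (1 : ℝ) ∈ Set.Icc ‖dil w 0 x‖ ‖dil w 1 x‖ by
        simp [dil_zero_left hw, dil_one, hx1])
    have hle : ρ z ≤ ρ (dil w s x) := hmin (by simpa using hs1)
    rw [hρ.homog, abs_of_nonneg hs.1] at hle
    exact absurd (hle.trans (mul_le_of_le_one_left (hρ.nonneg x) hs.2)) hx.not_ge

theorem exists_abs_apply_le (hρ : IsPseudoNorm w ρ) (hw : ∀ i, 0 < w i) :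
    ∃ C, 0 ≤ C ∧ ∀ x i, |x i| ≤ (C * ρ x) ^ w i := by
  obtain ⟨c, hc, h⟩ := hρ.exists_norm_lt_one_of_lt hw
  refine ⟨2 / c, by positivity, fun x i => ?_⟩
  obtain rfl | hx := eq_or_ne x 0
  · simp [hρ.apply_zero, (hw i).ne']
  · have hpos : 0 < 2 / c * ρ x := mul_pos (by positivity) (hρ.pos x hx)
    have hlt : ρ (dil w (2 / c * ρ x)⁻¹ x) < c := by
      rw [hρ.homog, abs_of_pos (inv_pos.mpr hpos)]
      have := (hρ.pos x hx).ne'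
      field_simp
      norm_num
    have hi := (norm_le_pi_norm _ i).trans (h _ hlt).le
    rw [dil, Real.norm_eq_abs, abs_mul, abs_pow, abs_of_pos (inv_pos.mpr hpos), inv_pow,
      inv_mul_le_iff₀ (pow_pos hpos _), mul_one] at hi
    exact hi

theorem exists_abs_monom_le (hρ : IsPseudoNorm w ρ) (hw : ∀ i, 0 < w i) (α : Fin n → ℕ) :
    ∃ C, 0 ≤ C ∧ ∀ x, |monom α x| ≤ C * ρ x ^ wlen w α := by
  obtain ⟨C, hC, h⟩ := hρ.exists_abs_apply_le hw
  refine ⟨C ^ wlen w α, by positivity, fun x => ?_⟩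
  rw [monom, Finset.abs_prod, ← mul_pow, wlen, ← Finset.prod_pow_eq_pow_sum]
  refine Finset.prod_le_prod (fun i _ => abs_nonneg _) fun i _ => ?_
  rw [abs_pow, pow_mul]
  exact pow_le_pow_left₀ (abs_nonneg _) (h x i) _

theorem isBigO_of_mem_weightedSpan (hρ : IsPseudoNorm w ρ) (hw : ∀ i, 0 < w i) {N : ℕ}
    {f : (Fin n → ℝ) → ℝ} (hf : f ∈ weightedSpan w N) :
    ∃ C : ℝ, ∀ᶠ x in 𝓝 (0 : Fin n → ℝ), |f x| ≤ C * ρ x ^ N := by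
  induction hf using Submodule.span_induction with
  | mem f hf =>
    obtain ⟨α, hα, g, hg, rfl⟩ := hf
    obtain ⟨C, hC, hmonom⟩ := hρ.exists_abs_monom_le hw α
    have hg_lt : ∀ᶠ x in 𝓝 (0 : Fin n → ℝ), |g x| < |g 0| + 1 :=
      hg.continuous.abs.continuousAt.eventually_lt continuousAt_const (lt_add_one _)
    have hρ_lt : ∀ᶠ x in 𝓝 (0 : Fin n → ℝ), ρ x < 1 :=
      hρ.cont.continuousAt.eventually_lt continuousAt_const (by simp [hρ.apply_zero])
    refine ⟨C * (|g 0| + 1), ?_⟩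
    filter_upwards [hg_lt, hρ_lt] with x hgx hρx
    calc |monom α x * g x| = |monom α x| * |g x| := abs_mul _ _
      _ ≤ (C * ρ x ^ N) * (|g 0| + 1) := by
        refine mul_le_mul ((hmonom x).trans ?_) hgx.le (abs_nonneg _)
          (mul_nonneg hC (pow_nonneg (hρ.nonneg x) _))
        exact mul_le_mul_of_nonneg_left (pow_le_pow_of_le_one (hρ.nonneg x) hρx.le hα) hC
      _ = _ := by ring
  | zero => exact ⟨0, by simp⟩
  | add f g _ _ hf hg =>
    obtain ⟨C, hC⟩ := hf
    obtain ⟨D, hD⟩ := hg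
    refine ⟨C + D, ?_⟩
    filter_upwards [hC, hD] with x hx hx'
    rw [add_mul]
    exact (abs_add_le _ _).trans (add_le_add hx hx')
  | smul a f _ hf =>
    obtain ⟨C, hC⟩ := hf
    refine ⟨|a| * C, ?_⟩
    filter_upwards [hC] with x hx
    rw [Pi.smul_apply, smul_eq_mul, abs_mul, mul_assoc]
    exact mul_le_mul_of_nonneg_left hx (abs_nonneg a)

end IsPseudoNorm

/-! ### Localization -/

theorem exists_contDiff_eventuallyEq {U : Set (Fin n → ℝ)} (hU : IsOpen U) {a : Fin n → ℝ}
    (ha : a ∈ U) {f : (Fin n → ℝ) → ℝ} (hf : ContDiffOn ℝ ∞ f U) :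
    ∃ g : (Fin n → ℝ) → ℝ, ContDiff ℝ ∞ g ∧ g =ᶠ[𝓝 a] f := by
  obtain ⟨r, hr, hrU⟩ := Metric.nhds_basis_closedBall.mem_iff.mp (hU.mem_nhds ha)
  let χ : ContDiffBump a := ⟨r / 2, r, half_pos hr, half_lt_self hr⟩
  refine ⟨fun x => χ x * f x, contDiff_iff_contDiffAt.mpr fun x => ?_, ?_⟩
  · by_cases hx : x ∈ U
    · exact χ.contDiffAt.mul (hf.contDiffAt (hU.mem_nhds hx))
    · have hx' : x ∉ tsupport χ := fun h => hx (hrU (χ.tsupport_eq ▸ h))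
      refine (contDiffAt_const (c := (0 : ℝ))).congr_of_eventuallyEq ?_
      filter_upwards [notMem_tsupport_iff_eventuallyEq.mp hx'] with y hy
      simp [hy]
  · filter_upwards [χ.eventuallyEq_one] with x hx
    simp [hx]

/-- A smooth quotient near `t = 0` glues with `t^{-N} f(t·x)` to a global smooth quotient. -/
theorem exists_smooth_quotient_of_eventuallyEq (hw : ∀ i, 0 < w i) {U : Set (Fin n → ℝ)}
    (hU : IsOpen U) {f g : (Fin n → ℝ) → ℝ} (hf : ContDiffOn ℝ ∞ f U) {N : ℕ}
    (hg : g ∈ weightedSpan w N) (hgf : g =ᶠ[𝓝 0] f) :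
    ∃ Θ : (Fin n → ℝ) × ℝ → ℝ,
      ContDiffOn ℝ ∞ Θ {p : (Fin n → ℝ) × ℝ | p.1 ∈ U ∧ dil w p.2 p.1 ∈ U} ∧
      ∀ p : (Fin n → ℝ) × ℝ, p.1 ∈ U → dil w p.2 p.1 ∈ U →
        f (dil w p.2 p.1) = p.2 ^ N * Θ p := by
  obtain ⟨Θ, hΘ, hgΘ⟩ := exists_smooth_quotient_of_mem_weightedSpan hg
  refine ⟨fun p => if p.2 = 0 then Θ p else (p.2 ^ N)⁻¹ * f (dil w p.2 p.1), ?_, ?_⟩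
  · rintro ⟨x, t⟩ ⟨hx, htx⟩
    refine ContDiffAt.contDiffWithinAt ?_
    by_cases ht : t = 0
    · subst ht
      refine hΘ.contDiffAt.congr_of_eventuallyEq ?_
      have hlim : Tendsto (fun p : (Fin n → ℝ) × ℝ => dil w p.2 p.1) (𝓝 (x, 0)) (𝓝 0) := by
        simpa [dil_zero_left hw] using (contDiff_dil w).continuous.tendsto (x, 0)
      filter_upwards [hlim.eventually hgf] with p hp
      split_ifs with hp0
      · rfl
      · rw [← hp, hgΘ, inv_mul_cancel_left₀ (pow_ne_zero _ hp0)]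
    · have hsmooth : ContDiffAt ℝ ∞
          (fun p : (Fin n → ℝ) × ℝ => (p.2 ^ N)⁻¹ * f (dil w p.2 p.1)) (x, t) :=
        ((contDiffAt_snd.pow N).inv (pow_ne_zero _ ht)).mul
          (ContDiffAt.comp (x, t) (hf.contDiffAt (hU.mem_nhds htx)) (contDiff_dil w).contDiffAt)
      refine hsmooth.congr_of_eventuallyEq ?_
      filter_upwards [continuousAt_snd.eventually_ne ht] with p hp
      rw [if_neg hp]
  · rintro ⟨x, t⟩ - -
    by_cases ht : t = 0
    · subst ht
      simp only [if_true]
      rw [← hgΘ (x, 0)]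
      simp only [dil_zero_left hw]
      exact hgf.eq_of_nhds.symm
    · simp only [if_neg ht]
      rw [mul_inv_cancel_left₀ (pow_ne_zero _ ht)]

end WeightedTaylor

/-- Characterizations of functions of weight `≥ N`. -/
theorem weight_ge_characterizations
    {n : ℕ} (hn : 0 < n) {w : Fin n → ℕ} (hw : IsWeight w)
    {U : Set (Fin n → ℝ)} (hU : IsOpen U) (h0 : (0 : Fin n → ℝ) ∈ U)
    {f : (Fin n → ℝ) → ℝ} (hf : ContDiffOn ℝ (⊤ : ℕ∞) f U) (N : ℕ)
    {ρ : (Fin n → ℝ) → ℝ} (hρ : IsPseudoNorm w ρ) :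
    List.TFAE [
      WeightGe w f N,
      ∃ C : ℝ, ∀ᶠ x in 𝓝 (0 : Fin n → ℝ), |f x| ≤ C * ρ x ^ N,
      ∀ x : Fin n → ℝ, ∃ C : ℝ, ∀ᶠ t in 𝓝[≠] (0 : ℝ),
        |f (dil w t x)| ≤ C * |t| ^ N,
      BigOC U (fun t x => f (dil w t x)) N,
      ∃ Θ : (Fin n → ℝ) × ℝ → ℝ,
        ContDiffOn ℝ (⊤ : ℕ∞) Θ {p : (Fin n → ℝ) × ℝ | p.1 ∈ U ∧ dil w p.2 p.1 ∈ U} ∧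
        ∀ p : (Fin n → ℝ) × ℝ, p.1 ∈ U → dil w p.2 p.1 ∈ U →
          f (dil w p.2 p.1) = p.2 ^ N * Θ p ] := by
  obtain ⟨g, hg, hgf⟩ := exists_contDiff_eventuallyEq hU h0 hf
  have hspan : WeightGe w f N → g ∈ weightedSpan w N := fun h =>
    mem_weightedSpan_of_weightGe hw.pos hg (weightGe_congr hgf.symm h)
  tfae_have 1 → 5 := fun h =>
    exists_smooth_quotient_of_eventuallyEq hw.pos hU hf (hspan h) hgf
  tfae_have 5 → 4 := fun ⟨Θ, hΘ, h⟩ => bigOC_of_smooth_quotient hU h0 hw.pos hΘ h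
  tfae_have 4 → 1 := weightGe_of_bigOC h0
  tfae_have 1 → 2 := fun h => by
    obtain ⟨C, hC⟩ := hρ.isBigO_of_mem_weightedSpan hw.pos (hspan h)
    refine ⟨C, ?_⟩
    filter_upwards [hC, hgf] with x hx hgx
    rwa [← hgx]
  tfae_have 2 → 3 := fun ⟨C, hC⟩ x => by
    refine ⟨C * ρ x ^ N, ?_⟩
    filter_upwards [(tendsto_dil hw.pos x).eventually hC] with t ht
    rw [hρ.homog, mul_pow] at ht
    linarith
  tfae_have 3 → 1 := fun h => by
    refine weightGe_congr hgf (weightGe_of_mem_weightedSpan hw.pos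
      (mem_weightedSpan_of_isBigO hw.pos hg fun x => ?_))
    obtain ⟨C, hC⟩ := h x
    refine ⟨C, ?_⟩
    filter_upwards [hC, (tendsto_dil hw.pos x).eventually hgf] with t ht hgt
    rwa [hgt]
  tfae_finish

end Carnot
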